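/- Let N ≥ 1 be an integer, l ∈ ℤ, and τ ∈ ℂ with Im τ > 0. For s ≥ 0 set τ_s := τ + is/(2πN). Then the half-form-corrected norm of the gCST-evolved lowest Landau level state is independent of s: for all s ≥ 0, √(Im τ_s/(2πN)) · ∫₀¹∫₀¹ |θ_{l/N}(N(x+τ_s y), Nτ_s)·exp(iπNτ_s y²)|² dx dy = 1/(2N√π). In particular the gCST with half-form correction is norm-preserving along the family of flat Kähler structures parametrized by τ_s. -/

import Mathlib

open scoped BigOperators

/-- Theta function with characteristic `a`:
`θ_a(w,σ) = Σ_{n∈ℤ} exp(iπσ(n+a)² + 2πi(n+a)w)`. -/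
noncomputable def jtheta (a : ℝ) (w σ : ℂ) : ℂ :=
  ∑' n : ℤ, Complex.exp (Real.pi * Complex.I * σ * ((n : ℂ) + (a : ℂ)) ^ 2 +
    2 * Real.pi * Complex.I * ((n : ℂ) + (a : ℂ)) * w)

/-- Orthogonality of the exponentials `x ↦ exp (2πimx)` on the unit interval. -/
theorem integral_exp_two_pi_int (m : ℤ) :
    ∫ x in (0 : ℝ)..1, Complex.exp (2 * Real.pi * Complex.I * m * x) = if m = 0 then 1 else 0 := by
  split_ifs with hm
  · simp [hm]
  · have hc : 2 * (Real.pi : ℂ) * Complex.I * m ≠ 0 :=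
      mul_ne_zero Complex.two_pi_I_ne_zero (Int.cast_ne_zero.mpr hm)
    rw [integral_exp_mul_complex hc]
    have h : Complex.exp (2 * (Real.pi : ℂ) * Complex.I * m) = 1 :=
      Complex.exp_eq_one_iff.mpr ⟨m, by ring⟩
    simp [h]

theorem norm_exp_two_pi_int (m : ℤ) (x : ℝ) :
    ‖Complex.exp (2 * Real.pi * Complex.I * m * x)‖ = 1 := by
  rw [Complex.norm_exp]
  simp

/-- Parseval's identity for an absolutely convergent trigonometric series with distinct
integer frequencies. -/
theorem integral_norm_sq_tsum_exp {ι : Type*} [Countable ι] {c : ι → ℂ}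
    (hc : Summable fun n => ‖c n‖) {k : ι → ℤ} (hk : Function.Injective k) :
    ∫ x in (0 : ℝ)..1, ‖∑' n, c n * Complex.exp (2 * Real.pi * Complex.I * k n * x)‖ ^ 2 =
      ∑' n, ‖c n‖ ^ 2 := by
  classical
  let e : ι × ι → ℝ → ℂ := fun p x =>
    c p.1 * (starRingEnd ℂ) (c p.2) *
      Complex.exp (2 * Real.pi * Complex.I * ((k p.1 - k p.2 : ℤ) : ℂ) * x)
  have hexpand (x : ℝ) :
      ((‖∑' n, c n * Complex.exp (2 * Real.pi * Complex.I * k n * x)‖ ^ 2 : ℝ) : ℂ) =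
        ∑' p, e p x := by
    have hs : Summable fun n => ‖c n * Complex.exp (2 * Real.pi * Complex.I * k n * x)‖ := by
      simpa only [norm_mul, norm_exp_two_pi_int, mul_one] using hc
    have hs' : Summable fun n =>
        ‖(starRingEnd ℂ) (c n * Complex.exp (2 * Real.pi * Complex.I * k n * x))‖ := by
      simpa only [RCLike.norm_conj] using hs
    rw [Complex.ofReal_pow, ← Complex.mul_conj', Complex.conj_tsum,
      tsum_mul_tsum_of_summable_norm hs hs']
    refine tsum_congr fun p => ?_
    simp only [e, map_mul, ← Complex.exp_conj, Complex.conj_I, Complex.conj_ofReal, map_ofNat,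
      map_intCast]
    rw [mul_mul_mul_comm, ← Complex.exp_add]
    congr 2
    push_cast
    ring
  have hnorm (p : ι × ι) (x : ℝ) : ‖e p x‖ = ‖c p.1‖ * ‖c p.2‖ := by
    simp only [e, norm_mul, norm_exp_two_pi_int, mul_one, RCLike.norm_conj]
  have hint (p : ι × ι) :
      ∫ x in (0 : ℝ)..1, e p x = if p.1 = p.2 then (‖c p.1‖ ^ 2 : ℂ) else 0 := by
    simp only [e]
    rw [intervalIntegral.integral_const_mul, integral_exp_two_pi_int]
    by_cases h : p.1 = p.2
    · simp [h, Complex.mul_conj']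
    · simp [h, sub_eq_zero, hk.ne h]
  have hsum : HasSum (fun p => ∫ x in (0 : ℝ)..1, e p x) (∫ x in (0 : ℝ)..1, ∑' p, e p x) := by
    simp only [intervalIntegral.integral_of_le zero_le_one]
    refine MeasureTheory.hasSum_integral_of_summable_integral_norm (fun p => ?_) ?_
    · have : Continuous (e p) := by fun_prop
      exact this.integrableOn_Ioc
    · simp only [hnorm]
      simpa using hc.mul_of_nonneg hc (fun _ => norm_nonneg _) (fun _ => norm_nonneg _)
  apply Complex.ofReal_injective
  rw [← intervalIntegral.integral_ofReal, Complex.ofReal_tsum]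
  simp only [hexpand]
  rw [← hsum.tsum_eq]
  simp only [hint]
  have hdiag : Function.Injective fun n : ι => (n, n) := fun a b h => congrArg Prod.fst h
  rw [← hdiag.tsum_eq]
  · simp
  · rintro ⟨a, b⟩ h
    by_cases hab : a = b
    · exact ⟨a, by simp [hab]⟩
    · simp [hab] at h

/-- Translated Gaussians are summable over the integers. -/
theorem summable_norm_exp_int_add_sq (b : ℝ) {σ : ℂ} (hσ : 0 < σ.im) :
    Summable fun n : ℤ => ‖Complex.exp (Real.pi * Complex.I * σ * ((n : ℂ) + b) ^ 2)‖ := by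
  have h := (((summable_jacobiTheta₂_term_iff (σ * b) σ).mpr hσ).mul_left
    (Complex.exp (Real.pi * Complex.I * σ * b ^ 2))).norm
  refine h.congr fun n => ?_
  rw [jacobiTheta₂_term, ← Complex.exp_add]
  ring_nf

theorem norm_exp_pi_I_mul_sq (σ : ℂ) (u : ℝ) :
    ‖Complex.exp (Real.pi * Complex.I * σ * (u : ℂ) ^ 2)‖ =
      Real.exp (-(Real.pi * σ.im) * u ^ 2) := by
  rw [Complex.norm_exp, ← Complex.ofReal_pow, Complex.re_mul_ofReal]
  simp

/-- Unfolding: integrating the periodization of a nonnegative integrable function over a period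
gives its integral over the line. -/
theorem integral_tsum_comp_add_int {f : ℝ → ℝ} (hf : MeasureTheory.Integrable f)
    (hf0 : ∀ x, 0 ≤ f x) :
    ∫ y in (0 : ℝ)..1, ∑' n : ℤ, f (y + n) = ∫ u, f u := by
  have h := hf.hasSum_intervalIntegral_comp_add_int
  rw [← h.tsum_eq]
  simp only [intervalIntegral.integral_of_le zero_le_one] at h ⊢
  refine (MeasureTheory.hasSum_integral_of_summable_integral_norm (fun n => ?_) ?_).tsum_eq.symm
  · exact (hf.comp_add_right (n : ℝ)).integrableOn
  · simpa only [Real.norm_of_nonneg (hf0 _)] using h.summable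

theorem jtheta_mul_exp {N : ℕ} (hN : N ≠ 0) (l : ℤ) (τ : ℂ) (x y : ℝ) :
    jtheta ((l : ℝ) / (N : ℝ)) ((N : ℂ) * ((x : ℂ) + τ * (y : ℂ))) ((N : ℂ) * τ) *
        Complex.exp (Real.pi * Complex.I * (N : ℂ) * τ * (y : ℂ) ^ 2) =
      ∑' n : ℤ, Complex.exp (Real.pi * Complex.I * (N * τ) *
          ((n : ℂ) + ((l / N + y : ℝ) : ℂ)) ^ 2) *
        Complex.exp (2 * Real.pi * Complex.I * ((n * N + l : ℤ) : ℂ) * x) := by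
  have hN' : (N : ℂ) ≠ 0 := Nat.cast_ne_zero.mpr hN
  rw [jtheta, ← tsum_mul_right]
  refine tsum_congr fun n => ?_
  rw [← Complex.exp_add, ← Complex.exp_add]
  congr 1
  push_cast
  field_simp
  ring

theorem integral_norm_sq_jtheta {N : ℕ} (hN : N ≠ 0) (l : ℤ) {τ : ℂ} (hτ : 0 < τ.im) :
    ∫ y in (0 : ℝ)..1, ∫ x in (0 : ℝ)..1,
        ‖(jtheta ((l : ℝ) / (N : ℝ)) ((N : ℂ) * ((x : ℂ) + τ * (y : ℂ))) ((N : ℂ) * τ) *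
          Complex.exp (Real.pi * Complex.I * (N : ℂ) * τ * (y : ℂ) ^ 2))‖ ^ 2 =
      Real.sqrt (1 / (2 * N * τ.im)) := by
  have hN' : 0 < (N : ℝ) := Nat.cast_pos.mpr (Nat.pos_of_ne_zero hN)
  have him : ((N : ℂ) * τ).im = N * τ.im := by simp
  have hσ : 0 < ((N : ℂ) * τ).im := him ▸ mul_pos hN' hτ
  have hk : Function.Injective fun n : ℤ => n * N + l := fun a b h => by
    simpa [hN] using h
  have hb : 0 < 2 * Real.pi * (N * τ.im) := by positivity
  let f : ℝ → ℝ := fun u => Real.exp (-(2 * Real.pi * (N * τ.im)) * (u + l / N) ^ 2)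
  have hf : MeasureTheory.Integrable f :=
    (integrable_exp_neg_mul_sq hb).comp_add_right ((l : ℝ) / N)
  have hinner (y : ℝ) : ∫ x in (0 : ℝ)..1,
      ‖(jtheta ((l : ℝ) / (N : ℝ)) ((N : ℂ) * ((x : ℂ) + τ * (y : ℂ))) ((N : ℂ) * τ) *
        Complex.exp (Real.pi * Complex.I * (N : ℂ) * τ * (y : ℂ) ^ 2))‖ ^ 2 =
      ∑' n : ℤ, f (y + n) := by
    simp only [jtheta_mul_exp hN]
    rw [integral_norm_sq_tsum_exp (summable_norm_exp_int_add_sq (l / N + y) hσ) hk]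
    refine tsum_congr fun n => ?_
    rw [← Complex.ofReal_intCast, ← Complex.ofReal_add, norm_exp_pi_I_mul_sq, him,
      ← Real.exp_nat_mul]
    simp only [f]
    congr 1
    push_cast
    ring
  simp only [hinner]
  rw [integral_tsum_comp_add_int hf fun _ => (Real.exp_pos _).le]
  simp only [f]
  rw [MeasureTheory.integral_add_right_eq_self
    (fun u : ℝ => Real.exp (-(2 * Real.pi * (N * τ.im)) * u ^ 2)), integral_gaussian]
  congr 1
  field_simp

/-- The half-form-corrected norm of the gCST-evolved lowest Landau level state is
independent of `s`: with `τ_s = τ + is/(2πN)` and half-form factor `√(Im τ_s/(2πN))`,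
the squared norm equals `1/(2N√π)` for all `s ≥ 0`. -/
theorem stmt_6 (N : ℕ) (hN : 1 ≤ N) (l : ℤ) (τ : ℂ) (hτ : 0 < τ.im) :
    ∀ s : ℝ, 0 ≤ s → ∀ τs : ℂ, τs = τ + Complex.I * s / (2 * Real.pi * N) →
      Real.sqrt (τs.im / (2 * Real.pi * N)) *
        (∫ y in (0:ℝ)..1, ∫ x in (0:ℝ)..1,
          ‖(jtheta ((l : ℝ) / (N : ℝ))
              ((N : ℂ) * ((x : ℂ) + τs * (y : ℂ))) ((N : ℂ) * τs) *
            Complex.exp (Real.pi * Complex.I * (N : ℂ) * τs * (y : ℂ) ^ 2))‖ ^ 2) =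
      1 / (2 * (N : ℝ) * Real.sqrt Real.pi) := by
  rintro s hs τs rfl
  have hN0 : N ≠ 0 := Nat.one_le_iff_ne_zero.mp hN
  have hN' : 0 < (N : ℝ) := Nat.cast_pos.mpr hN
  set τs : ℂ := τ + Complex.I * s / (2 * Real.pi * N) with hτs
  have him : 0 < τs.im := by
    have h : τs = τ + ((s / (2 * Real.pi * N) : ℝ) : ℂ) * Complex.I := by
      rw [hτs]
      push_cast
      ring
    rw [h, Complex.add_im, Complex.im_ofReal_mul, Complex.I_im]
    positivity
  rw [integral_norm_sq_jtheta hN0 l him, ← Real.sqrt_mul (by positivity)]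
  have h : τs.im / (2 * Real.pi * N) * (1 / (2 * N * τs.im)) =
      (1 / (2 * (N : ℝ) * Real.sqrt Real.pi)) ^ 2 := by
    rw [div_pow, mul_pow, Real.sq_sqrt Real.pi_pos.le]
    field_simp
  rw [h, Real.sqrt_sq (by positivity)]
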